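/- Let ψ be a one-local Haar-random product state on n qubits and let Q be a nontrivial n-qubit Pauli string of weight w(Q) ≥ 1 (the number of non-identity tensor factors). Then the second moment of its expectation value equals E[⟨ψ, Qψ⟩²] = 3^{−w(Q)}; in particular this variance is strictly positive. -/

import Mathlib

open MeasureTheory Matrix

noncomputable section

/-- `SU(2)`: the subgroup of the `2 × 2` complex unitary group consisting of matrices of
determinant `1`. -/
def SU2 : Subgroup (Matrix.unitaryGroup (Fin 2) ℂ) where
  carrier := {U | (U : Matrix (Fin 2) (Fin 2) ℂ).det = 1}
  one_mem' := by simp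
  mul_mem' := by
    intro a b ha hb
    simp only [Set.mem_setOf_eq] at *
    rw [Matrix.UnitaryGroup.mul_val, Matrix.det_mul, ha, hb, mul_one]
  inv_mem' := by
    intro a ha
    simp only [Set.mem_setOf_eq] at *
    rw [Matrix.UnitaryGroup.inv_val, Matrix.star_eq_conjTranspose,
      Matrix.det_conjTranspose, ha, star_one]

/-- The underlying `2 × 2` complex matrix of an element of `SU(2)`. -/
def SU2.mat (U : SU2) : Matrix (Fin 2) (Fin 2) ℂ := U.1.1

/-- The Hermitian inner product `⟨u, v⟩ = ∑ i, conj (u i) * v i`, conjugate-linear in the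
first argument. -/
def hInner {ι : Type*} [Fintype ι] (u v : ι → ℂ) : ℂ :=
  ∑ i, starRingEnd ℂ (u i) * v i

/-- The four single-qubit Pauli matrices `I, σ_x, σ_y, σ_z`. -/
def pauli : Fin 4 → Matrix (Fin 2) (Fin 2) ℂ
  | 0 => 1
  | 1 => !![0, 1; 1, 0]
  | 2 => !![0, -Complex.I; Complex.I, 0]
  | 3 => !![1, 0; 0, -1]

/-- The `n`-qubit Pauli string `τ₁ ⊗ ⋯ ⊗ τₙ`, as a matrix on `(ℂ²)^{⊗n}` (realized as
functions `(Fin n → Fin 2) → ℂ`). -/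
def pauliString {n : ℕ} (τ : Fin n → Fin 4) :
    Matrix (Fin n → Fin 2) (Fin n → Fin 2) ℂ :=
  fun x y => ∏ j, pauli (τ j) (x j) (y j)

/-- The elementary tensor `f 1 ⊗ ⋯ ⊗ f n` of single-qubit vectors, as a vector of
`(ℂ²)^{⊗n}` (realized as functions `(Fin n → Fin 2) → ℂ`). -/
def tensorVec {n : ℕ} (f : (j : Fin n) → Fin 2 → ℂ) : (Fin n → Fin 2) → ℂ :=
  fun x => ∏ j, f j (x j)


/-- The standard basis vector `e₀ = (1,0)ᵀ ∈ ℂ²`. -/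
def e0 : Fin 2 → ℂ := fun i => if i = 0 then 1 else 0

/-- The one-local Haar-random product state `ψ = (U₁ ⊗ ⋯ ⊗ Uₙ) e₀^{⊗n}` determined by
`U : Fin n → SU(2)` (the randomness lies in choosing `U` according to the product of Haar
measures). -/
def spreadState {n : ℕ} (U : Fin n → SU2) : (Fin n → Fin 2) → ℂ :=
  tensorVec fun j => (SU2.mat (U j)).mulVec e0

/-- The weight of an `n`-qubit Pauli string: the number of non-identity tensor factors. -/
def pauliWeight {n : ℕ} (τ : Fin n → Fin 4) : ℕ :=
  (Finset.univ.filter fun j => τ j ≠ 0).card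

/-- The expectation value `⟨U e₀, σ_t U e₀⟩` of a single-qubit Pauli matrix. -/
def qubitExpectation (t : Fin 4) (U : SU2) : ℂ :=
  hInner ((SU2.mat U).mulVec e0) ((pauli t).mulVec ((SU2.mat U).mulVec e0))

lemma hInner_pauliString_tensorVec {n : ℕ} (τ : Fin n → Fin 4) (f : Fin n → Fin 2 → ℂ) :
    hInner (tensorVec f) ((pauliString τ).mulVec (tensorVec f)) =
      ∏ j, hInner (f j) ((pauli (τ j)).mulVec (f j)) := by
  simp only [hInner, tensorVec, pauliString, Matrix.mulVec, dotProduct, map_prod,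
    ← Finset.prod_mul_distrib]
  rw [Finset.prod_univ_sum, Fintype.piFinset_univ]
  refine Finset.sum_congr rfl fun x _ => ?_
  rw [Finset.prod_mul_distrib, Finset.prod_univ_sum, Fintype.piFinset_univ]

lemma SU2.mat_mul (U V : SU2) : SU2.mat (U * V) = SU2.mat U * SU2.mat V := rfl

lemma SU2.continuous_mat : Continuous SU2.mat :=
  continuous_subtype_val.comp continuous_subtype_val

lemma SU2.norm_sq_mulVec_e0 (U : SU2) :
    Complex.normSq ((SU2.mat U).mulVec e0 0) + Complex.normSq ((SU2.mat U).mulVec e0 1) = 1 := by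
  have h : star (SU2.mat U) * SU2.mat U = 1 := Matrix.mem_unitaryGroup_iff'.1 U.1.2
  have h00 := congrFun (congrFun h 0) 0
  simp only [Matrix.mul_apply, Fin.sum_univ_two, Matrix.star_apply, Matrix.one_apply_eq,
    Complex.star_def, ← Complex.normSq_eq_conj_mul_self] at h00
  simp only [Matrix.mulVec, dotProduct, e0, Fin.sum_univ_two]
  simpa using mod_cast h00

/-- Conjugation by this element of `SU(2)` permutes the three Pauli matrices cyclically. -/
def pauliCycle : SU2 :=
  ⟨⟨!![⟨1 / 2, -1 / 2⟩, ⟨-1 / 2, -1 / 2⟩; ⟨1 / 2, -1 / 2⟩, ⟨1 / 2, 1 / 2⟩], by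
    rw [Matrix.mem_unitaryGroup_iff]
    ext i j
    fin_cases i <;> fin_cases j <;>
      simp [Matrix.mul_apply, Fin.sum_univ_two, Complex.ext_iff] <;> norm_num⟩, by
    change Matrix.det !![(⟨1 / 2, -1 / 2⟩ : ℂ), ⟨-1 / 2, -1 / 2⟩; ⟨1 / 2, -1 / 2⟩, ⟨1 / 2, 1 / 2⟩] = 1
    rw [Matrix.det_fin_two_of]
    simp [Complex.ext_iff]
    norm_num⟩

lemma hInner_pauli_pauliCycle (v : Fin 2 → ℂ) :
    hInner ((SU2.mat pauliCycle).mulVec v) ((pauli 2).mulVec ((SU2.mat pauliCycle).mulVec v)) =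
        hInner v ((pauli 1).mulVec v) ∧
      hInner ((SU2.mat pauliCycle).mulVec v) ((pauli 3).mulVec ((SU2.mat pauliCycle).mulVec v)) =
        hInner v ((pauli 2).mulVec v) := by
  constructor <;>
    simp [hInner, pauli, SU2.mat, pauliCycle, Matrix.mulVec, dotProduct, Fin.sum_univ_two,
      Complex.ext_iff] <;>
    constructor <;> ring

lemma qubitExpectation_pauliCycle_mul (U : SU2) :
    qubitExpectation 2 (pauliCycle * U) = qubitExpectation 1 U ∧
      qubitExpectation 3 (pauliCycle * U) = qubitExpectation 2 U := by
  simp only [qubitExpectation, SU2.mat_mul, ← Matrix.mulVec_mulVec]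
  exact hInner_pauli_pauliCycle _

lemma qubitExpectation_zero (U : SU2) : qubitExpectation 0 U = 1 := by
  have h := SU2.norm_sq_mulVec_e0 U
  simp only [qubitExpectation, hInner, pauli, Matrix.one_mulVec, Fin.sum_univ_two,
    ← Complex.normSq_eq_conj_mul_self]
  exact_mod_cast h

lemma exists_real_qubitExpectation (U : SU2) :
    ∃ x y z : ℝ, qubitExpectation 1 U = x ∧ qubitExpectation 2 U = y ∧
      qubitExpectation 3 U = z ∧ x ^ 2 + y ^ 2 + z ^ 2 = 1 := by
  have h := SU2.norm_sq_mulVec_e0 U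
  simp only [qubitExpectation]
  generalize (SU2.mat U).mulVec e0 = v at h ⊢
  simp only [Complex.normSq_apply] at h
  refine ⟨2 * ((v 0).re * (v 1).re + (v 0).im * (v 1).im),
    2 * ((v 0).re * (v 1).im - (v 0).im * (v 1).re),
    (v 0).re * (v 0).re + (v 0).im * (v 0).im - ((v 1).re * (v 1).re + (v 1).im * (v 1).im),
    ?_, ?_, ?_, ?_⟩
  iterate 3
    simp [hInner, pauli, Matrix.mulVec, dotProduct, Fin.sum_univ_two, Complex.ext_iff]
    constructor <;> ring
  linear_combination ((v 0).re * (v 0).re + (v 0).im * (v 0).im +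
    ((v 1).re * (v 1).re + (v 1).im * (v 1).im) + 1) * h

lemma continuous_qubitExpectation (t : Fin 4) : Continuous (qubitExpectation t) := by
  have h : Continuous fun U => (SU2.mat U).mulVec e0 :=
    SU2.continuous_mat.matrix_mulVec continuous_const
  have h' : Continuous fun U => (pauli t).mulVec ((SU2.mat U).mulVec e0) :=
    continuous_const.matrix_mulVec h
  unfold qubitExpectation hInner
  exact continuous_finsetSum _ fun i _ =>
    (Complex.continuous_conj.comp ((continuous_apply i).comp h)).mul
      ((continuous_apply i).comp h')

lemma norm_qubitExpectation_sq_le (t : Fin 4) (U : SU2) : ‖qubitExpectation t U ^ 2‖ ≤ 1 := by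
  obtain ⟨x, y, z, hx, hy, hz, h⟩ := exists_real_qubitExpectation U
  fin_cases t
  · simp [qubitExpectation_zero]
  all_goals
    simp only [Fin.mk_one, Fin.reduceFinMk, hx, hy, hz, norm_pow, Complex.norm_real,
      Real.norm_eq_abs, sq_abs]
    nlinarith [sq_nonneg x, sq_nonneg y, sq_nonneg z]

lemma integral_qubitExpectation_sq [MeasurableSpace SU2] [BorelSpace SU2]
    (μ : Measure SU2) [μ.IsMulLeftInvariant] [IsProbabilityMeasure μ] (t : Fin 4) :
    ∫ U, qubitExpectation t U ^ 2 ∂μ = if t = 0 then 1 else (3 : ℂ)⁻¹ := by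
  have hint (s : Fin 4) : Integrable (fun U => qubitExpectation s U ^ 2) μ :=
    Integrable.of_bound ((continuous_qubitExpectation s).pow 2).measurable.aestronglyMeasurable 1
      (Filter.Eventually.of_forall (norm_qubitExpectation_sq_le s))
  have h12 : ∫ U, qubitExpectation 2 U ^ 2 ∂μ = ∫ U, qubitExpectation 1 U ^ 2 ∂μ := by
    rw [← integral_mul_left_eq_self _ pauliCycle]
    simp only [(qubitExpectation_pauliCycle_mul _).1]
  have h23 : ∫ U, qubitExpectation 3 U ^ 2 ∂μ = ∫ U, qubitExpectation 2 U ^ 2 ∂μ := by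
    rw [← integral_mul_left_eq_self _ pauliCycle]
    simp only [(qubitExpectation_pauliCycle_mul _).2]
  have hsum : ∫ U, qubitExpectation 1 U ^ 2 ∂μ + ∫ U, qubitExpectation 2 U ^ 2 ∂μ +
      ∫ U, qubitExpectation 3 U ^ 2 ∂μ = 1 := by
    rw [← integral_add (hint 1) (hint 2), ← integral_add (by exact (hint 1).add (hint 2)) (hint 3)]
    have hone (U : SU2) : qubitExpectation 1 U ^ 2 + qubitExpectation 2 U ^ 2 +
        qubitExpectation 3 U ^ 2 = 1 := by
      obtain ⟨x, y, z, hx, hy, hz, h⟩ := exists_real_qubitExpectation U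
      rw [hx, hy, hz]
      exact_mod_cast h
    simp [hone]
  have h1 : ∫ U, qubitExpectation 1 U ^ 2 ∂μ = (3 : ℂ)⁻¹ := by
    rw [h23, h12] at hsum
    linear_combination hsum / 3
  fin_cases t
  · simp [qubitExpectation_zero]
  · simpa using h1
  · simpa using h12.trans h1
  · simpa using h23.trans (h12.trans h1)

/-- For a one-local Haar-random product state `ψ` on `n` qubits and a nontrivial
`n`-qubit Pauli string `Q` of weight `w(Q) ≥ 1`, the second moment of its expectation
value is `E[⟨ψ, Qψ⟩²] = 3^{-w(Q)}`; in particular this variance is strictly positive. -/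
theorem pauli_expectation_second_moment [MeasurableSpace SU2] [BorelSpace SU2]
    (μ : Measure SU2) [μ.IsHaarMeasure] [IsProbabilityMeasure μ]
    (n : ℕ) (τ : Fin n → Fin 4) (hτ : 1 ≤ pauliWeight τ) :
    (∫ U : Fin n → SU2,
        hInner (spreadState U) ((pauliString τ).mulVec (spreadState U)) ^ 2
        ∂(Measure.pi fun _ : Fin n => μ))
      = ((3 : ℂ) ^ pauliWeight τ)⁻¹ := by
  simp only [spreadState, hInner_pauliString_tensorVec, ← Finset.prod_pow]
  refine (integral_fintype_prod_eq_prod (𝕜 := ℂ)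
    (fun j U => qubitExpectation (τ j) U ^ 2)).trans ?_
  simp only [integral_qubitExpectation_sq, pauliWeight]
  rw [Finset.prod_ite]
  simp

end
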